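/- In 𝒪_q(Mat_n), set x_{ij} := Σ_{k=1}^{n} t_{ik} t_{jk} for 1 ≤ i,j ≤ n. Then: (i) x_{ij} = q x_{ji} for all i < j; and (ii) for all l, d, h, k ∈ {1,…,n}: Σ_{j,s,a,v} r^{ld}_{js} x_{ja} r^{hs}_{av} x_{vk} = Σ_{s,a,b,u} x_{ds} r^{as}_{lb} x_{au} r^{ub}_{hk} (the entrywise form of the reflection-type matrix equation R X₁ R^{t₁} X₂ = X₂ R^{t₁} X₁ R, where X = (x_{ij})). -/

import Mathlib

open scoped BigOperators TensorProduct

noncomputable section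

abbrev K : Type := RatFunc ℂ

def q : K := RatFunc.X

/-- The standard R-matrix of `U_q(gl_N)`: the coefficient of `e_{ik} ⊗ e_{jl}` is the
entry at row `(i,j)`, column `(k,l)`. -/
def Rmat (N : ℕ) : Matrix (Fin N × Fin N) (Fin N × Fin N) K :=
  Matrix.of fun p c =>
    if p.1 = c.1 ∧ p.2 = c.2 then (if p.1 = p.2 then q else 1)
    else if p.1 = c.2 ∧ p.2 = c.1 ∧ c.1 < p.1 then q - q⁻¹
    else 0

/-- partial transpose in the first tensor factor -/
def pt1 {N : ℕ} {α : Type} (C : Matrix (Fin N × Fin N) (Fin N × Fin N) α) :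
    Matrix (Fin N × Fin N) (Fin N × Fin N) α :=
  Matrix.of fun p c => C (c.1, p.2) (p.1, c.2)

/-- partial transpose in the second tensor factor -/
def pt2 {N : ℕ} {α : Type} (C : Matrix (Fin N × Fin N) (Fin N × Fin N) α) :
    Matrix (Fin N × Fin N) (Fin N × Fin N) α :=
  Matrix.of fun p c => C (p.1, c.2) (c.1, p.2)

/-- flip of the two tensor factors -/
def flip21 {N : ℕ} {α : Type} (C : Matrix (Fin N × Fin N) (Fin N × Fin N) α) :
    Matrix (Fin N × Fin N) (Fin N × Fin N) α :=
  Matrix.of fun p c => C (p.2, p.1) (c.2, c.1)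

/-- the generator `t_{ij}` of the free algebra -/
def Tg {n : ℕ} (i j : Fin n) : FreeAlgebra K (Fin n × Fin n) := FreeAlgebra.ι K (i, j)

/-- defining relations of `𝒪_q(Mat_n)` -/
inductive matRel (n : ℕ) :
    FreeAlgebra K (Fin n × Fin n) → FreeAlgebra K (Fin n × Fin n) → Prop
  | rowq (l i j : Fin n) (h : i < j) :
      matRel n (Tg l i * Tg l j) (q • (Tg l j * Tg l i))
  | colq (l i j : Fin n) (h : i < j) :
      matRel n (Tg i l * Tg j l) (q • (Tg j l * Tg i l))
  | anti (i k j l : Fin n) (h1 : i < k) (h2 : j < l) :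
      matRel n (Tg i l * Tg k j) (Tg k j * Tg i l)
  | main (i k j l : Fin n) (h1 : i < k) (h2 : j < l) :
      matRel n (Tg i j * Tg k l) (Tg k l * Tg i j + (q - q⁻¹) • (Tg k j * Tg i l))

/-- the quantized function algebra `𝒪_q(Mat_n)` -/
abbrev OqMat (n : ℕ) := RingQuot (matRel n)

/-- the generator `t_{ij}` of `𝒪_q(Mat_n)` -/
def tGen {n : ℕ} (i j : Fin n) : OqMat n :=
  RingQuot.mkAlgHom K (matRel n) (Tg i j)

/-- the Type AI quantum symmetric matrix generators `x_{ij} = Σ_k t_{ik} t_{jk}` -/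
def xAI {n : ℕ} (i j : Fin n) : OqMat n := ∑ k : Fin n, tGen i k * tGen j k

open Matrix

section Reflection

variable {n : ℕ} {A : Type} [Ring A]

/-- the matrix `X ⊗ 1` acting in the first tensor factor -/
def leg1 (X : Matrix (Fin n) (Fin n) A) : Matrix (Fin n × Fin n) (Fin n × Fin n) A :=
  Matrix.of fun p c => if p.2 = c.2 then X p.1 c.1 else 0

/-- the matrix `1 ⊗ X` acting in the second tensor factor -/
def leg2 (X : Matrix (Fin n) (Fin n) A) : Matrix (Fin n × Fin n) (Fin n × Fin n) A :=
  Matrix.of fun p c => if p.1 = c.1 then X p.2 c.2 else 0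

lemma mul_leg1_apply (M : Matrix (Fin n × Fin n) (Fin n × Fin n) A)
    (X : Matrix (Fin n) (Fin n) A) (p c : Fin n × Fin n) :
    (M * leg1 X) p c = ∑ a, M p (a, c.2) * X a c.1 := by
  simp [leg1, Matrix.mul_apply, Fintype.sum_prod_type]

lemma leg1_mul_apply (M : Matrix (Fin n × Fin n) (Fin n × Fin n) A)
    (X : Matrix (Fin n) (Fin n) A) (p c : Fin n × Fin n) :
    (leg1 X * M) p c = ∑ a, X p.1 a * M (a, p.2) c := by
  simp [leg1, Matrix.mul_apply, Fintype.sum_prod_type]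

lemma mul_leg2_apply (M : Matrix (Fin n × Fin n) (Fin n × Fin n) A)
    (X : Matrix (Fin n) (Fin n) A) (p c : Fin n × Fin n) :
    (M * leg2 X) p c = ∑ a, M p (c.1, a) * X a c.2 := by
  simp [leg2, Matrix.mul_apply, Fintype.sum_prod_type]

lemma leg2_mul_apply (M : Matrix (Fin n × Fin n) (Fin n × Fin n) A)
    (X : Matrix (Fin n) (Fin n) A) (p c : Fin n × Fin n) :
    (leg2 X * M) p c = ∑ a, X p.2 a * M (p.1, a) c := by
  simp [leg2, Matrix.mul_apply, Fintype.sum_prod_type]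

lemma leg1_mul (X Y : Matrix (Fin n) (Fin n) A) : leg1 (X * Y) = leg1 X * leg1 Y := by
  ext p c
  rw [leg1_mul_apply]
  by_cases h : p.2 = c.2 <;> simp [leg1, Matrix.mul_apply, h]

lemma leg2_mul (X Y : Matrix (Fin n) (Fin n) A) : leg2 (X * Y) = leg2 X * leg2 Y := by
  ext p c
  rw [leg2_mul_apply]
  by_cases h : p.1 = c.1 <;> simp [leg2, Matrix.mul_apply, h]

lemma sum_Rmat_row {M : Type} [AddCommGroup M] [Module K M] (f : Fin n → Fin n → M)
    (i j : Fin n) :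
    ∑ a, ∑ b, Rmat n (i, j) (a, b) • f a b =
      (if i = j then q else 1) • f i j + (if j < i then q - q⁻¹ else 0) • f j i := by
  have h : ∀ a b, Rmat n (i, j) (a, b) • f a b =
      (if i = a then if j = b then (if i = j then q else 1) • f i j else 0 else 0) +
      (if j = a then if i = b then (if j < i then q - q⁻¹ else 0) • f j i else 0 else 0) := by
    intro a b
    simp only [Rmat, Matrix.of_apply, ite_smul, zero_smul]
    split_ifs <;> grind
  simp only [h, Finset.sum_add_distrib]
  simp

lemma sum_Rmat_col {M : Type} [AddCommGroup M] [Module K M] (f : Fin n → Fin n → M)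
    (k l : Fin n) :
    ∑ a, ∑ b, Rmat n (a, b) (k, l) • f a b =
      (if k = l then q else 1) • f k l + (if k < l then q - q⁻¹ else 0) • f l k := by
  have h : ∀ a b, Rmat n (a, b) (k, l) • f a b =
      (if k = a then if l = b then (if k = l then q else 1) • f k l else 0 else 0) +
      (if l = a then if k = b then (if k < l then q - q⁻¹ else 0) • f l k else 0 else 0) := by
    intro a b
    simp only [Rmat, Matrix.of_apply, ite_smul, zero_smul]
    split_ifs <;> grind
  simp only [h, Finset.sum_add_distrib]
  simp

lemma pt1_Rmat_apply_of_ne {i j k l : Fin n} (h : i ≠ j ∨ k ≠ l) :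
    pt1 (Rmat n) (i, j) (k, l) = if i = k ∧ j = l then 1 else 0 := by
  simp only [pt1, Rmat, Matrix.of_apply]
  split_ifs <;> grind

/-- the R-matrix commutes with its partial transpose -/
lemma Rmat_mul_pt1 : Rmat n * pt1 (Rmat n) = pt1 (Rmat n) * Rmat n := by
  ext ⟨i, j⟩ ⟨k, l⟩
  have h1 := sum_Rmat_row (fun a b => pt1 (Rmat n) (a, b) (k, l)) i j
  have h2 := sum_Rmat_col (fun a b => pt1 (Rmat n) (i, j) (a, b)) k l
  simp only [smul_eq_mul] at h1 h2
  simp only [Matrix.mul_apply, Fintype.sum_prod_type]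
  rw [h1]
  simp only [mul_comm (pt1 (Rmat n) _ _) _]
  rw [h2]
  by_cases hij : i = j
  · subst hij
    by_cases hkl : k = l
    · subst hkl
      simp
    · rw [pt1_Rmat_apply_of_ne (.inr hkl), pt1_Rmat_apply_of_ne (.inr (Ne.symm hkl))]
      grind
  · rw [pt1_Rmat_apply_of_ne (.inl hij), pt1_Rmat_apply_of_ne (.inl hij),
      pt1_Rmat_apply_of_ne (.inl (Ne.symm hij))]
    grind

variable [Algebra K A]

/-- the R-matrix with entries viewed in a `K`-algebra -/
def RmatIn (n : ℕ) (A : Type) [Ring A] [Algebra K A] :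
    Matrix (Fin n × Fin n) (Fin n × Fin n) A :=
  (Rmat n).map (algebraMap K A)

lemma RmatIn_apply (p c : Fin n × Fin n) : RmatIn n A p c = algebraMap K A (Rmat n p c) := rfl

lemma pt1_apply {α : Type} (C : Matrix (Fin n × Fin n) (Fin n × Fin n) α) (p c : Fin n × Fin n) :
    pt1 C p c = C (c.1, p.2) (p.1, c.2) := rfl

lemma RmatIn_mul_pt1 : RmatIn n A * pt1 (RmatIn n A) = pt1 (RmatIn n A) * RmatIn n A := by
  have h : pt1 (RmatIn n A) = (pt1 (Rmat n)).map (algebraMap K A) := rfl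
  rw [h, RmatIn, ← Matrix.map_mul, ← Matrix.map_mul, Rmat_mul_pt1]

/-- the entrywise form of `R T₁ T₂ = T₂ T₁ R` -/
def IsRTT (T : Matrix (Fin n) (Fin n) A) : Prop :=
  ∀ i j k l, ∑ a, ∑ b, Rmat n (i, j) (a, b) • (T a k * T b l) =
    ∑ a, ∑ b, Rmat n (a, b) (k, l) • (T j b * T i a)

lemma IsRTT.mul_leg1_mul_leg2 {T : Matrix (Fin n) (Fin n) A} (hT : IsRTT T) :
    RmatIn n A * leg1 T * leg2 T = leg2 T * leg1 T * RmatIn n A := by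
  ext ⟨i, j⟩ ⟨k, l⟩
  have h := hT i j k l
  simp only [mul_assoc (leg2 T)]
  simp only [mul_leg1_apply, mul_leg2_apply, leg1_mul_apply, leg2_mul_apply, RmatIn_apply,
    ← Algebra.smul_def, ← Algebra.commutes, Finset.sum_mul, Finset.mul_sum, smul_mul_assoc,
    mul_smul_comm]
  rw [Finset.sum_comm, h, Finset.sum_comm]

lemma IsRTT.leg1_transpose_mul_pt1 {T : Matrix (Fin n) (Fin n) A} (hT : IsRTT T) :
    leg1 Tᵀ * pt1 (RmatIn n A) * leg2 T = leg2 T * pt1 (RmatIn n A) * leg1 Tᵀ := by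
  ext ⟨k, j⟩ ⟨i, l⟩
  have h := hT i j k l
  simp only [mul_leg1_apply, mul_leg2_apply, leg1_mul_apply, leg2_mul_apply, RmatIn_apply,
    pt1_apply, Matrix.transpose_apply,
    ← Algebra.smul_def, ← Algebra.commutes, Finset.sum_mul, smul_mul_assoc]
  rw [Finset.sum_comm, h]

lemma reflection_equation {T : Matrix (Fin n) (Fin n) A} (hT : IsRTT T) (hT' : IsRTT Tᵀ) :
    RmatIn n A * leg1 (T * Tᵀ) * pt1 (RmatIn n A) * leg2 (T * Tᵀ) =
      leg2 (T * Tᵀ) * pt1 (RmatIn n A) * leg1 (T * Tᵀ) * RmatIn n A := by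
  have h1 := hT.mul_leg1_mul_leg2
  have h2 := hT'.mul_leg1_mul_leg2
  have h3 := hT.leg1_transpose_mul_pt1
  have h4 := hT'.leg1_transpose_mul_pt1
  rw [Matrix.transpose_transpose] at h4
  have h5 := RmatIn_mul_pt1 (n := n) (A := A)
  simp only [leg1_mul, leg2_mul]
  generalize RmatIn n A = R at *
  generalize pt1 R = R' at *
  calc R * (leg1 T * leg1 Tᵀ) * R' * (leg2 T * leg2 Tᵀ)
      = R * leg1 T * (leg1 Tᵀ * R' * leg2 T) * leg2 Tᵀ := by simp only [mul_assoc]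
    _ = (R * leg1 T * leg2 T) * R' * leg1 Tᵀ * leg2 Tᵀ := by rw [h3]; simp only [mul_assoc]
    _ = leg2 T * leg1 T * (R * R') * leg1 Tᵀ * leg2 Tᵀ := by rw [h1]; simp only [mul_assoc]
    _ = leg2 T * leg1 T * R' * (R * leg1 Tᵀ * leg2 Tᵀ) := by rw [h5]; simp only [mul_assoc]
    _ = leg2 T * (leg1 T * R' * leg2 Tᵀ) * leg1 Tᵀ * R := by rw [h2]; simp only [mul_assoc]
    _ = leg2 T * leg2 Tᵀ * R' * (leg1 T * leg1 Tᵀ) * R := by rw [h4]; simp only [mul_assoc]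

/-- the entrywise form of the reflection equation -/
lemma reflection_equation_entries {X : Matrix (Fin n) (Fin n) A}
    (hX : RmatIn n A * leg1 X * pt1 (RmatIn n A) * leg2 X =
      leg2 X * pt1 (RmatIn n A) * leg1 X * RmatIn n A) (l d h k : Fin n) :
    ∑ j, ∑ s, ∑ a, ∑ v, (Rmat n (l, d) (j, s) * Rmat n (h, s) (a, v)) • (X j a * X v k) =
      ∑ s, ∑ a, ∑ b, ∑ u, (Rmat n (a, s) (l, b) * Rmat n (u, b) (h, k)) • (X d s * X a u) := by
  have key := congrFun (congrFun hX (l, d)) (h, k)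
  simp only [mul_assoc] at key
  rw [Matrix.mul_apply, leg2_mul_apply] at key
  simp only [leg1_mul_apply, mul_leg2_apply, Fintype.sum_prod_type] at key
  simp only [Matrix.mul_apply (M := pt1 (RmatIn n A)), leg1_mul_apply,
    Fintype.sum_prod_type, RmatIn_apply, pt1_apply, Finset.mul_sum] at key
  convert key using 8 with j _ s _ a _ v
  · simp only [← Algebra.smul_def, mul_smul_comm, smul_smul, mul_comm]
  · rw [← Algebra.commutes]
    simp only [← Algebra.smul_def, mul_smul_comm, smul_smul, mul_comm]

lemma q_ne_zero : q ≠ 0 := RatFunc.X_ne_zero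

/-- quantum matrices satisfy the RTT relation -/
lemma isRTT_of_relations {T : Matrix (Fin n) (Fin n) A}
    (row : ∀ l i j, i < j → T l i * T l j = q • (T l j * T l i))
    (col : ∀ l i j, i < j → T i l * T j l = q • (T j l * T i l))
    (anti : ∀ i k j l, i < k → j < l → T i l * T k j = T k j * T i l)
    (main : ∀ i k j l, i < k → j < l →
      T i j * T k l = T k l * T i j + (q - q⁻¹) • (T k j * T i l)) :
    IsRTT T := by
  have hq := mul_inv_cancel₀ q_ne_zero
  intro i j k l
  rw [sum_Rmat_row, sum_Rmat_col (fun a b => T j b * T i a)]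
  rcases lt_trichotomy i j with hij | rfl | hij <;>
  rcases lt_trichotomy k l with hkl | rfl | hkl
  · simp [hij.ne, hkl.ne, hkl, hij.not_gt, main i j k l hij hkl]
  · simp [hij.ne, hij.not_gt, col k i j hij]
  · simp [hij.ne, hkl.ne', hij.not_gt, hkl.not_gt, anti i j l k hij hkl]
  · simp only [if_true, lt_irrefl, if_false, hkl.ne, hkl, row i k l hkl]
    simp only [smul_smul, ← add_smul]
    congr 1
    grind
  · simp
  · simp [hkl.ne', hkl.not_gt, row i l k hkl]
  · simp only [hij.ne', hij, hkl.ne, hkl, if_true, if_false, one_smul, anti j i k l hij hkl]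
  · simp only [if_true, lt_irrefl, if_false, hij.ne', hij, col k j i hij]
    simp only [smul_smul, ← add_smul]
    congr 1
    grind
  · simp [hij.ne', hkl.ne', hij, hkl.not_gt, main j i l k hij hkl, anti j i l k hij hkl]

end Reflection

section Generators

variable {n : ℕ}

lemma tGen_row (l i j : Fin n) (h : i < j) :
    tGen l i * tGen l j = q • (tGen l j * tGen l i) := by
  simpa only [tGen, map_mul, map_smul] using RingQuot.mkAlgHom_rel K (matRel.rowq l i j h)

lemma tGen_col (l i j : Fin n) (h : i < j) :
    tGen i l * tGen j l = q • (tGen j l * tGen i l) := by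
  simpa only [tGen, map_mul, map_smul] using RingQuot.mkAlgHom_rel K (matRel.colq l i j h)

lemma tGen_anti (i k j l : Fin n) (h1 : i < k) (h2 : j < l) :
    tGen i l * tGen k j = tGen k j * tGen i l := by
  simpa only [tGen, map_mul] using RingQuot.mkAlgHom_rel K (matRel.anti i k j l h1 h2)

lemma tGen_main (i k j l : Fin n) (h1 : i < k) (h2 : j < l) :
    tGen i j * tGen k l = tGen k l * tGen i j + (q - q⁻¹) • (tGen k j * tGen i l) := by
  simpa only [tGen, map_mul, map_add, map_smul] using
    RingQuot.mkAlgHom_rel K (matRel.main i k j l h1 h2)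

lemma isRTT_tGen : IsRTT (Matrix.of (tGen (n := n))) :=
  isRTT_of_relations tGen_row tGen_col tGen_anti tGen_main

lemma isRTT_transpose_tGen : IsRTT (Matrix.of (tGen (n := n)))ᵀ :=
  isRTT_of_relations tGen_col tGen_row
    (fun i k j l h1 h2 => (tGen_anti j l i k h2 h1).symm)
    (fun i k j l h1 h2 => by
      simpa only [Matrix.transpose_apply, Matrix.of_apply, tGen_anti j l i k h2 h1] using
        tGen_main j l i k h2 h1)

end Generators

theorem stmt5 (n : ℕ) :
    (∀ i j : Fin n, i < j → xAI i j = q • xAI j i) ∧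
    (∀ l d h k : Fin n,
      (∑ j : Fin n, ∑ s : Fin n, ∑ a : Fin n, ∑ v : Fin n,
        (Rmat n (l, d) (j, s) * Rmat n (h, s) (a, v)) • (xAI j a * xAI v k)) =
      (∑ s : Fin n, ∑ a : Fin n, ∑ b : Fin n, ∑ u : Fin n,
        (Rmat n (a, s) (l, b) * Rmat n (u, b) (h, k)) • (xAI d s * xAI a u))) := by
  refine ⟨fun i j hij => ?_, fun l d h k => ?_⟩
  · simp only [xAI, Finset.smul_sum]
    exact Finset.sum_congr rfl fun c _ => tGen_col c i j hij
  · exact reflection_equation_entries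
      (reflection_equation (isRTT_tGen (n := n)) isRTT_transpose_tGen) l d h k
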